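/- arXiv:2410.06378 — 2 statements merged into one kernel-verified Lean document; each statement's English description precedes it below -/
import Mathlib

section
/- There exists an absolute constant C ∈ ℝ_+ such that for every p ∈ [1,∞], all d, W, L ∈ ℕ with W ≥ d, every B ∈ ℝ_+ with B ≥ 1, and every ε ∈ (0, 1/2), the covering number of the class R(d,W,L,B) of ReLU network realizations satisfies log N(ε, R(d,W,L,B), L^p([0,1]^d)) ≤ C · W²L · log((W+1)^L B^L / ε). -/
open MeasureTheory ProbabilityTheory ENNReal

noncomputable section

/-- A ReLU network configuration with input dimension `d`:
a finite sequence of matrix–vector pairs `(A_i, b_i)`, `i = 0, …, depth − 1`. -/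
structure ReLUNet (d : ℕ) where
  depth : ℕ
  depth_pos : 0 < depth
  width : ℕ → ℕ
  width_in : width 0 = d
  width_out : width depth = 1
  A : ∀ i : ℕ, Matrix (Fin (width (i + 1))) (Fin (width i)) ℝ
  b : ∀ i : ℕ, Fin (width (i + 1)) → ℝ

namespace ReLUNet

variable {d : ℕ}

/-- The affine map `x ↦ A_i x + b_i` of layer `i`. -/
def layer (Φ : ReLUNet d) (i : ℕ) (x : Fin (Φ.width i) → ℝ) :
    Fin (Φ.width (i + 1)) → ℝ :=
  fun j => (∑ k, Φ.A i j k * x k) + Φ.b i j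

/-- Output after the first `i` affine layers, with the ReLU activation `ρ(x) = max{x,0}`
applied between consecutive affine layers (not on the input and not after the last
affine layer). -/
def forward (Φ : ReLUNet d) : (i : ℕ) → (Fin (Φ.width 0) → ℝ) → Fin (Φ.width i) → ℝ
  | 0, x => x
  | i + 1, x =>
      Φ.layer i fun k => if i = 0 then Φ.forward i x k else max (Φ.forward i x k) 0

/-- The realization `R(Φ) : ℝ^d → ℝ` of a network configuration. -/
def realization (Φ : ReLUNet d) (x : Fin d → ℝ) : ℝ :=
  Φ.forward Φ.depth (fun k => x (Fin.cast Φ.width_in k)) (Fin.cast Φ.width_out.symm 0)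

/-- All layer widths are at most `W`. -/
def widthLe (Φ : ReLUNet d) (W : ℕ) : Prop :=
  ∀ i ≤ Φ.depth, Φ.width i ≤ W

/-- All weights have absolute value at most `B`. -/
def magLe (Φ : ReLUNet d) (B : ℝ) : Prop :=
  ∀ i < Φ.depth, (∀ j k, |Φ.A i j k| ≤ B) ∧ ∀ j, |Φ.b i j| ≤ B

/-- All weights take values in the set `𝔸`. -/
def coefIn (Φ : ReLUNet d) (𝔸 : Set ℝ) : Prop :=
  ∀ i < Φ.depth, (∀ j k, Φ.A i j k ∈ 𝔸) ∧ ∀ j, Φ.b i j ∈ 𝔸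

open Classical in
/-- The connectivity (total number of nonzero weights) of a network configuration. -/
def connectivity (Φ : ReLUNet d) : ℕ :=
  ∑ i ∈ Finset.range Φ.depth,
    ((Finset.univ.filter fun jk : Fin (Φ.width (i + 1)) × Fin (Φ.width i) =>
        Φ.A i jk.1 jk.2 ≠ 0).card
      + (Finset.univ.filter fun j : Fin (Φ.width (i + 1)) => Φ.b i j ≠ 0).card)

end ReLUNet

/-- `R(d,W,L,B)`: realizations of ReLU networks with input dimension `d`, output
dimension 1, width at most `W`, depth at most `L`, and weight magnitude at most `B`. -/
def RclassB (d W L : ℕ) (B : ℝ) : Set ((Fin d → ℝ) → ℝ) :=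
  {f | ∃ Φ : ReLUNet d, Φ.widthLe W ∧ Φ.depth ≤ L ∧ Φ.magLe B ∧ Φ.realization = f}

/-- `R(d,W,L)`: realizations with width at most `W` and depth at most `L`,
with no constraint on the weight magnitude. -/
def Rclass (d W L : ℕ) : Set ((Fin d → ℝ) → ℝ) :=
  {f | ∃ Φ : ReLUNet d, Φ.widthLe W ∧ Φ.depth ≤ L ∧ Φ.realization = f}

/-- `R_𝔸(d,W,L)`: realizations with width at most `W`, depth at most `L`, and all
weights taking values in `𝔸`. -/
def RclassCoef (d W L : ℕ) (𝔸 : Set ℝ) : Set ((Fin d → ℝ) → ℝ) :=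
  {f | ∃ Φ : ReLUNet d, Φ.widthLe W ∧ Φ.depth ≤ L ∧ Φ.coefIn 𝔸 ∧ Φ.realization = f}

/-- `R(d,W,L,B,s)`: realizations with width ≤ `W`, depth ≤ `L`, weight magnitude ≤ `B`,
and connectivity ≤ `s`. -/
def RclassSparse (d W L : ℕ) (B : ℝ) (s : ℕ) : Set ((Fin d → ℝ) → ℝ) :=
  {f | ∃ Φ : ReLUNet d, Φ.widthLe W ∧ Φ.depth ≤ L ∧ Φ.magLe B ∧
    Φ.connectivity ≤ s ∧ Φ.realization = f}

/-- The unit cube `[0,1]^d`. -/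
def unitCube (d : ℕ) : Set (Fin d → ℝ) := Set.univ.pi fun _ => Set.Icc (0 : ℝ) 1

/-- The `L^p([0,1]^d)` distance between two functions on `ℝ^d` (with `p = ⊤`
corresponding to `L^∞`). -/
def cubeDist (d : ℕ) (p : ℝ≥0∞) (f g : (Fin d → ℝ) → ℝ) : ℝ≥0∞ :=
  eLpNorm (f - g) p (volume.restrict (unitCube d))

/-- The `L^p([0,1])` distance between two functions on `ℝ`. -/
def intervalDist (p : ℝ≥0∞) (f g : ℝ → ℝ) : ℝ≥0∞ :=
  eLpNorm (f - g) p (volume.restrict (Set.Icc (0 : ℝ) 1))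

/-- The `ε`-covering number of `X` with respect to the extended distance `δ`:
the cardinality of a smallest subset `C ⊆ X` such that every point of `X` is within
distance `ε` of some point of `C` (equal to `⊤` if no finite covering exists). -/
def coveringNumber {α : Type*} (ε : ℝ≥0∞) (X : Set α) (δ : α → α → ℝ≥0∞) : ℕ∞ :=
  sInf {n : ℕ∞ | ∃ C : Finset α, ↑C ⊆ X ∧ (∀ x ∈ X, ∃ c ∈ C, δ x c ≤ ε) ∧ (C.card : ℕ∞) = n}

/-- The `ε`-packing number of `X` with respect to the extended distance `δ`:
the cardinality of a largest subset of `X` whose points have pairwise distances `> ε`. -/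
def packingNumber {α : Type*} (ε : ℝ≥0∞) (X : Set α) (δ : α → α → ℝ≥0∞) : ℕ∞ :=
  sSup {n : ℕ∞ | ∃ C : Finset α, ↑C ⊆ X ∧
    (∀ x ∈ C, ∀ y ∈ C, x ≠ y → ε < δ x y) ∧ (C.card : ℕ∞) = n}

/-- Base-2 logarithm of an extended natural number, valued in `ℝ≥0∞`. -/
def elog2 (n : ℕ∞) : ℝ≥0∞ :=
  if n = ⊤ then ⊤ else ENNReal.ofReal (Real.logb 2 (n.toNat : ℝ))

/-- The minimax approximation error `A(G, F, δ) = sup_{g ∈ G} inf_{f ∈ F} δ(f, g)`. -/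
def minimaxErr {α : Type*} (G F : Set α) (δ : α → α → ℝ≥0∞) : ℝ≥0∞ :=
  ⨆ g ∈ G, ⨅ f ∈ F, δ f g

namespace ReLUNet

variable {d : ℕ}

/-- The weight matrices of a network, extended by zero to all natural indices. -/
def extA (Φ : ReLUNet d) (i j k : ℕ) : ℝ :=
  if h : i < Φ.depth ∧ j < Φ.width (i + 1) ∧ k < Φ.width i then
    Φ.A i ⟨j, h.2.1⟩ ⟨k, h.2.2⟩ else 0

/-- The bias vectors of a network, extended by zero to all natural indices. -/
def extB (Φ : ReLUNet d) (i j : ℕ) : ℝ :=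
  if h : i < Φ.depth ∧ j < Φ.width (i + 1) then Φ.b i ⟨j, h.2⟩ else 0

/-- The output after the first `i` affine layers, extended by zero to all natural indices. -/
def extForward (Φ : ReLUNet d) (x : Fin d → ℝ) (i j : ℕ) : ℝ :=
  if h : j < Φ.width i then
    Φ.forward i (fun k => x (Fin.cast Φ.width_in k)) ⟨j, h⟩ else 0

/-- The activation applied before the affine layer `i`: none for `i = 0`, and ReLU otherwise. -/
def act (i : ℕ) (y : ℝ) : ℝ := if i = 0 then y else max y 0

lemma abs_act_sub_le (i : ℕ) (y z : ℝ) : |act i y - act i z| ≤ |y - z| := by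
  unfold act
  split_ifs
  · exact le_rfl
  · exact abs_max_sub_max_le_abs y z 0

lemma abs_act_le (i : ℕ) (y : ℝ) : |act i y| ≤ |y| := by
  simpa [act] using abs_act_sub_le i y 0

lemma realization_eq_extForward (Φ : ReLUNet d) (x : Fin d → ℝ) :
    Φ.realization x = Φ.extForward x Φ.depth 0 := by
  have h : 0 < Φ.width Φ.depth := by simp [Φ.width_out]
  rw [extForward, dif_pos h]
  rfl

lemma abs_extForward_zero_le (Φ : ReLUNet d) {x : Fin d → ℝ} (hx : x ∈ unitCube d) (j : ℕ) :
    |Φ.extForward x 0 j| ≤ 1 := by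
  unfold extForward
  split_ifs with h
  · obtain ⟨h₀, h₁⟩ : x (Fin.cast Φ.width_in ⟨j, h⟩) ∈ Set.Icc (0 : ℝ) 1 := hx _ (Set.mem_univ _)
    exact abs_le.2 ⟨le_trans (by norm_num) h₀, h₁⟩
  · simp

lemma extForward_zero_eq (Φ Ψ : ReLUNet d) (x : Fin d → ℝ) (j : ℕ) :
    Φ.extForward x 0 j = Ψ.extForward x 0 j := by
  simp only [extForward, Φ.width_in, Ψ.width_in]
  rfl

lemma extForward_succ (Φ : ReLUNet d) {W : ℕ} (hW : Φ.widthLe W) (x : Fin d → ℝ) {i : ℕ}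
    (hi : i < Φ.depth) (j : ℕ) :
    Φ.extForward x (i + 1) j =
      ∑ k ∈ Finset.range W, Φ.extA i j k * act i (Φ.extForward x i k) + Φ.extB i j := by
  by_cases hj : j < Φ.width (i + 1)
  · have hsub : Finset.range (Φ.width i) ⊆ Finset.range W :=
      Finset.range_subset_range.2 (hW i hi.le)
    rw [← Finset.sum_subset hsub, Finset.sum_range]
    · simp [extForward, extA, extB, hj, hi, forward, layer, act]
    · intro k _ hk
      simp only [Finset.mem_range] at hk
      simp [extA, hk]
  · simp [extForward, extA, extB, hj]

lemma abs_extA_le (Φ : ReLUNet d) {B : ℝ} (hB : 0 ≤ B) (h : Φ.magLe B) (i j k : ℕ) :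
    |Φ.extA i j k| ≤ B := by
  unfold extA
  split_ifs with hh
  · exact (h i hh.1).1 _ _
  · simpa

lemma abs_extB_le (Φ : ReLUNet d) {B : ℝ} (hB : 0 ≤ B) (h : Φ.magLe B) (i j : ℕ) :
    |Φ.extB i j| ≤ B := by
  unfold extB
  split_ifs with hh
  · exact (h i hh.1).2 _
  · simpa

lemma abs_extForward_le (Φ : ReLUNet d) {W : ℕ} {B : ℝ} (hW : Φ.widthLe W) (hB : 1 ≤ B)
    (h : Φ.magLe B) {x : Fin d → ℝ} (hx : x ∈ unitCube d) (i : ℕ) (hi : i ≤ Φ.depth) (j : ℕ) :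
    |Φ.extForward x i j| ≤ (((W : ℝ) + 1) * B) ^ i := by
  have hB0 : 0 ≤ B := by linarith
  induction i generalizing j with
  | zero => simpa using Φ.abs_extForward_zero_le hx j
  | succ i ih =>
    have hM : 1 ≤ (((W : ℝ) + 1) * B) ^ i := one_le_pow₀ (by nlinarith [Nat.cast_nonneg (α := ℝ) W])
    rw [Φ.extForward_succ hW x hi j]
    set M := (((W : ℝ) + 1) * B) ^ i with hMdef
    have hsum : |∑ k ∈ Finset.range W, Φ.extA i j k * act i (Φ.extForward x i k)|
        ≤ W * (B * M) := by
      refine (Finset.abs_sum_le_sum_abs _ _).trans ?_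
      refine (Finset.sum_le_card_nsmul _ _ (B * M) fun k _ => ?_).trans (by simp)
      rw [abs_mul]
      exact mul_le_mul (Φ.abs_extA_le hB0 h i j k)
        ((abs_act_le _ _).trans (ih (by omega) k)) (abs_nonneg _) hB0
    calc _ ≤ W * (B * M) + B :=
          (abs_add_le _ _).trans (add_le_add hsum (Φ.abs_extB_le hB0 h i j))
      _ ≤ (((W : ℝ) + 1) * B) ^ (i + 1) := by
          rw [pow_succ, ← hMdef]
          nlinarith

lemma abs_extForward_sub_le (Φ Ψ : ReLUNet d) {W : ℕ} {B η : ℝ} (hΦW : Φ.widthLe W)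
    (hΨW : Ψ.widthLe W) (hB : 1 ≤ B) (hΦ : Φ.magLe B) (hΨ : Ψ.magLe B) (hη : 0 ≤ η)
    (hdepth : Φ.depth = Ψ.depth)
    (hA : ∀ i < Φ.depth, ∀ j < W, ∀ k < W, |Φ.extA i j k - Ψ.extA i j k| ≤ η)
    (hb : ∀ i < Φ.depth, ∀ j < W, |Φ.extB i j - Ψ.extB i j| ≤ η)
    {x : Fin d → ℝ} (hx : x ∈ unitCube d) (i : ℕ) (hi : i ≤ Φ.depth) (j : ℕ) (hj : j < W) :
    |Φ.extForward x i j - Ψ.extForward x i j| ≤ i * η * (((W : ℝ) + 1) * B) ^ i := by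
  have hB0 : 0 ≤ B := by linarith
  induction i generalizing j with
  | zero => simp [extForward_zero_eq Φ Ψ]
  | succ i ih =>
    have hM : 1 ≤ (((W : ℝ) + 1) * B) ^ i := one_le_pow₀ (by nlinarith [Nat.cast_nonneg (α := ℝ) W])
    rw [Φ.extForward_succ hΦW x hi j, Ψ.extForward_succ hΨW x (hdepth ▸ hi) j,
      add_sub_add_comm, ← Finset.sum_sub_distrib]
    have hΦM := Φ.abs_extForward_le hΦW hB hΦ hx i (by omega)
    set M := (((W : ℝ) + 1) * B) ^ i with hMdef
    have hsum : |∑ k ∈ Finset.range W, (Φ.extA i j k * act i (Φ.extForward x i k)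
        - Ψ.extA i j k * act i (Ψ.extForward x i k))| ≤ W * (η * M + B * (i * η * M)) := by
      refine (Finset.abs_sum_le_sum_abs _ _).trans ?_
      refine (Finset.sum_le_card_nsmul _ _ (η * M + B * (i * η * M)) fun k hk => ?_).trans
        (by rw [nsmul_eq_mul, Finset.card_range])
      have hk := Finset.mem_range.1 hk
      have hsplit : Φ.extA i j k * act i (Φ.extForward x i k)
          - Ψ.extA i j k * act i (Ψ.extForward x i k)
          = (Φ.extA i j k - Ψ.extA i j k) * act i (Φ.extForward x i k)
            + Ψ.extA i j k * (act i (Φ.extForward x i k) - act i (Ψ.extForward x i k)) := by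
        ring
      rw [hsplit]
      refine (abs_add_le _ _).trans (add_le_add ?_ ?_)
      · rw [abs_mul]
        exact mul_le_mul (hA i hi j hj k hk) ((abs_act_le _ _).trans (hΦM k)) (abs_nonneg _) hη
      · rw [abs_mul]
        exact mul_le_mul (Ψ.abs_extA_le hB0 hΨ i j k)
          ((abs_act_sub_le _ _ _).trans (ih (by omega) k hk)) (abs_nonneg _) hB0
    calc _ ≤ W * (η * M + B * (i * η * M)) + η :=
          (abs_add_le _ _).trans (add_le_add hsum (hb i hi j hj))
      _ ≤ W * (η * M + B * (i * η * M)) + η * M := by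
          gcongr
          exact le_mul_of_one_le_right hη hM
      _ = ((W : ℝ) + 1) * 1 * (η * M) + W * (B * (i * η * M)) := by ring
      _ ≤ ((W : ℝ) + 1) * B * (η * M) + (W + 1) * (B * (i * η * M)) := by
          gcongr
          linarith
      _ = ((i + 1 : ℕ) : ℝ) * η * (((W : ℝ) + 1) * B) ^ (i + 1) := by
          rw [pow_succ, ← hMdef]
          push_cast
          ring

end ReLUNet

/-- If the points of `X` carry labels in a finite type such that points with equal labels are
`ε`-close, then the covering number of `X` is at most the number of labels. -/
lemma coveringNumber_le_card {α κ : Type*} [Fintype κ] {ε : ℝ≥0∞} {X : Set α}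
    {δ : α → α → ℝ≥0∞} (key : X → κ) (h : ∀ x y : X, key x = key y → δ x y ≤ ε) :
    coveringNumber ε X δ ≤ Fintype.card κ := by
  classical
  let rep : Set.range key → X := Function.surjInv Set.rangeFactorization_surjective
  have hrep : ∀ k, key (rep k) = k := fun k =>
    congrArg Subtype.val (Function.surjInv_eq Set.rangeFactorization_surjective k)
  let C : Finset α := Finset.univ.image fun k => (rep k : α)
  have hcard : (C.card : ℕ∞) ≤ Fintype.card κ := by
    exact_mod_cast Finset.card_image_le.trans (Fintype.card_subtype_le _)
  refine le_trans (sInf_le ?_) hcard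
  refine ⟨C, ?_, fun x hx => ?_, rfl⟩
  · intro y hy
    obtain ⟨k, -, rfl⟩ := Finset.mem_image.1 (Finset.mem_coe.1 hy)
    exact (rep k).2
  · refine ⟨rep ⟨key ⟨x, hx⟩, ⟨x, hx⟩, rfl⟩, Finset.mem_image_of_mem _ (Finset.mem_univ _), ?_⟩
    exact h ⟨x, hx⟩ _ (hrep ⟨key ⟨x, hx⟩, ⟨x, hx⟩, rfl⟩).symm

lemma cubeDist_le {d : ℕ} (p : ℝ≥0∞) {f g : (Fin d → ℝ) → ℝ} {ε : ℝ}
    (h : ∀ x ∈ unitCube d, |f x - g x| ≤ ε) : cubeDist d p f g ≤ ENNReal.ofReal ε := by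
  have hvol : (volume.restrict (unitCube d)) Set.univ = 1 := by
    rw [Measure.restrict_apply_univ, unitCube, volume_pi_pi]
    simp
  have hmeas : MeasurableSet (unitCube d) := MeasurableSet.univ_pi fun _ => measurableSet_Icc
  refine (eLpNorm_le_of_ae_bound (C := ε) ?_).trans (by simp [hvol])
  exact (ae_restrict_iff' hmeas).2 (Filter.Eventually.of_forall fun x hx => h x hx)

lemma elog2_le {n : ℕ∞} {m : ℕ} (h : n ≤ m) {y : ℝ} (hm : 0 < m) (hy : Real.logb 2 m ≤ y) :
    elog2 n ≤ ENNReal.ofReal y := by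
  have hn : n ≠ ⊤ := ne_top_of_le_ne_top (ENat.natCast_ne_top m) h
  lift n to ℕ using hn
  rw [elog2, if_neg (ENat.natCast_ne_top n)]
  refine ENNReal.ofReal_le_ofReal (le_trans ?_ hy)
  have hnm : n ≤ m := by exact_mod_cast h
  rcases Nat.eq_zero_or_pos n with rfl | hn
  · simpa using Real.logb_nonneg one_lt_two (by exact_mod_cast hm)
  · exact Real.logb_le_logb_of_le one_lt_two (by exact_mod_cast hn) (by exact_mod_cast hnm)

lemma floor_div_mem_Icc {a B η : ℝ} (hη : 0 < η) (ha : |a| ≤ B) :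
    ⌊a / η⌋ ∈ Finset.Icc (-⌈B / η⌉) ⌈B / η⌉ := by
  obtain ⟨h₁, h₂⟩ := abs_le.1 ha
  rw [Finset.mem_Icc, ← Int.floor_neg, ← neg_div]
  refine ⟨Int.floor_le_floor (by gcongr), ?_⟩
  exact (Int.floor_le_ceil _).trans (Int.ceil_le_ceil (by gcongr))

lemma abs_sub_le_of_floor_div_eq {a b η : ℝ} (hη : 0 < η) (h : ⌊a / η⌋ = ⌊b / η⌋) :
    |a - b| ≤ η := by
  have := Int.abs_sub_lt_one_of_floor_eq_floor h
  rw [← sub_div, abs_div, abs_of_pos hη, div_lt_one hη] at this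
  exact this.le

/-- Rounding all weights to a grid of width `η` labels the networks in `RclassB d W L B` by
finitely many labels. -/
lemma coveringNumber_RclassB_le (p : ℝ≥0∞) {d W L : ℕ} {B ε η : ℝ} (hW : 0 < W) (hB : 1 ≤ B)
    (hη : 0 < η) (hε : L * η * (((W : ℝ) + 1) * B) ^ L ≤ ε) :
    coveringNumber (ENNReal.ofReal ε) (RclassB d W L B) (cubeDist d p) ≤
      (((L + 1) * (2 * ⌈B / η⌉ + 1).toNat ^ (L * W * (W + 1)) : ℕ) : ℕ∞) := by
  have hB0 : 0 ≤ B := by linarith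
  let S := Finset.Icc (-⌈B / η⌉) ⌈B / η⌉
  have hΦ : ∀ f : RclassB d W L B, ∃ Φ : ReLUNet d,
    Φ.widthLe W ∧ Φ.depth ≤ L ∧ Φ.magLe B ∧ Φ.realization = f := fun f => f.2
  choose Φ hwidth hdepth hmag hreal using hΦ
  let key : RclassB d W L B →
      Fin (L + 1) × (Fin L × Fin W × Fin W → S) × (Fin L × Fin W → S) := fun f =>
    ⟨⟨(Φ f).depth, Nat.lt_succ_of_le (hdepth f)⟩,
      fun t => ⟨_, floor_div_mem_Icc hη ((Φ f).abs_extA_le hB0 (hmag f) t.1 t.2.1 t.2.2)⟩,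
      fun t => ⟨_, floor_div_mem_Icc hη ((Φ f).abs_extB_le hB0 (hmag f) t.1 t.2)⟩⟩
  refine (coveringNumber_le_card key fun f g hfg => cubeDist_le p fun x hx => ?_).trans ?_
  · simp only [key, Prod.mk.injEq, funext_iff, Subtype.mk.injEq, Fin.mk.injEq] at hfg
    obtain ⟨hdep, hA, hb⟩ := hfg
    have hL := hdepth f
    rw [← hreal f, ← hreal g, ReLUNet.realization_eq_extForward,
      ReLUNet.realization_eq_extForward, ← hdep]
    refine (ReLUNet.abs_extForward_sub_le (Φ f) (Φ g) (hwidth f) (hwidth g) hB (hmag f) (hmag g)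
      hη.le hdep (fun i hi j hj k hk => ?_) (fun i hi j hj => ?_) hx _ le_rfl 0 hW).trans ?_
    · exact abs_sub_le_of_floor_div_eq hη (hA ⟨⟨i, by omega⟩, ⟨j, hj⟩, ⟨k, hk⟩⟩)
    · exact abs_sub_le_of_floor_div_eq hη (hb ⟨⟨i, by omega⟩, ⟨j, hj⟩⟩)
    · refine le_trans ?_ hε
      have : 1 ≤ ((W : ℝ) + 1) * B := by nlinarith [Nat.cast_nonneg (α := ℝ) W]
      gcongr
  · have hS : Fintype.card S = (2 * ⌈B / η⌉ + 1).toNat := by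
      rw [Fintype.card_coe, Int.card_Icc]
      congr 1
      ring
    simp only [Fintype.card_prod, Fintype.card_fun, Fintype.card_fin, hS, ← pow_add]
    refine le_of_eq ?_
    congr 3
    ring

/-- Covering number upper bound for fully-connected ReLU networks with
uniformly bounded weights. -/
theorem covering_upper_bound_fully_connected :
    ∃ C : ℝ, 0 < C ∧
      ∀ (p : ℝ≥0∞) (d W L : ℕ) (B ε : ℝ),
        1 ≤ p → 0 < d → 0 < L → d ≤ W → 1 ≤ B → 0 < ε → ε < 1 / 2 →
        elog2 (coveringNumber (ENNReal.ofReal ε) (RclassB d W L B) (cubeDist d p))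
          ≤ ENNReal.ofReal
              (C * ((W : ℝ) ^ 2 * L) * Real.logb 2 (((W : ℝ) + 1) ^ L * B ^ L / ε)) := by
  refine ⟨13, by norm_num, fun p d W L B ε _ hd hL hdW hB hε hε2 => ?_⟩
  have hW : 0 < W := by omega
  rw [← mul_pow]
  set Q := (((W : ℝ) + 1) * B) ^ L with hQ
  have hW1 : (1 : ℝ) ≤ W := by exact_mod_cast hW
  have hL1 : (1 : ℝ) ≤ L := by exact_mod_cast hL
  have hbase : 2 ≤ ((W : ℝ) + 1) * B := by nlinarith
  have hQL : (L : ℝ) + 1 ≤ Q := by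
    have h2 : L + 1 ≤ 2 ^ L := Nat.lt_two_pow_self
    calc (L : ℝ) + 1 ≤ 2 ^ L := by exact_mod_cast h2
      _ ≤ Q := by rw [hQ]; gcongr
  have hQB : B ≤ Q :=
    (show B ≤ ((W : ℝ) + 1) * B by nlinarith).trans (le_self_pow₀ (by linarith) hL.ne')
  have hQ0 : 0 < Q := by linarith
  have hQT : 2 * Q ≤ Q / ε := by
    rw [le_div_iff₀ hε]
    nlinarith
  set T := Q / ε with hT
  have hT4 : 4 ≤ T := by linarith
  have hη : 0 < ε / (L * Q) := by positivity
  have hcov := coveringNumber_RclassB_le p (d := d) (L := L) (ε := ε) hW hB hη (by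
    rw [← hQ]; apply le_of_eq; field_simp)
  have hBη : B / (ε / (L * Q)) = B * L * T := by rw [hT]; field_simp
  rw [hBη] at hcov
  have hceil0 : 0 ≤ ⌈B * L * T⌉ := Int.ceil_nonneg (by positivity)
  have hcells : (((2 * ⌈B * L * T⌉ + 1).toNat : ℕ) : ℝ) ≤ T ^ 6 := by
    have hcast : (((2 * ⌈B * L * T⌉ + 1).toNat : ℕ) : ℝ) = 2 * (⌈B * L * T⌉ : ℝ) + 1 := by
      rw [← Int.cast_natCast, Int.toNat_of_nonneg (by omega)]
      push_cast
      rfl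
    have hBLT : B * L * T ≤ T * T * T := by
      gcongr
      · linarith
      · linarith
    have hT3 : 4 * 4 * 4 ≤ T * T * T := by gcongr
    rw [hcast]
    calc 2 * (⌈B * L * T⌉ : ℝ) + 1 ≤ 2 * (T * T * T + 1) + 1 := by
          linarith [Int.ceil_lt_add_one (B * L * T)]
      _ ≤ (T * T * T) * (T * T * T) := by nlinarith
      _ = T ^ 6 := by ring
  have hexp : L * W * (W + 1) ≤ 2 * (W ^ 2 * L) := by nlinarith [Nat.mul_le_mul_left (L * W) hW]
  refine elog2_le hcov (Nat.mul_pos L.succ_pos (pow_pos (by omega) _)) ?_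
  have hbound : (((L + 1) * (2 * ⌈B * L * T⌉ + 1).toNat ^ (L * W * (W + 1)) : ℕ) : ℝ)
      ≤ T ^ (13 * (W ^ 2 * L)) := by
    push_cast
    calc _ ≤ T * (T ^ 6) ^ (L * W * (W + 1)) := by
          gcongr
          linarith
      _ = T ^ (1 + 6 * (L * W * (W + 1))) := by rw [← pow_mul, pow_add, pow_one]
      _ ≤ T ^ (13 * (W ^ 2 * L)) := by
          refine pow_le_pow_right₀ (by linarith) ?_
          have : 0 < W ^ 2 * L := by positivity
          omega
  refine (Real.logb_le_logb_of_le one_lt_two ?_ hbound).trans (le_of_eq ?_)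
  · exact_mod_cast Nat.mul_pos L.succ_pos (pow_pos (by omega) _)
  · rw [Real.logb_pow]
    push_cast
    ring
end
end

section
/- There exists an absolute constant c ∈ ℝ_+ such that for every p ∈ [1,∞], all d, W, L ∈ ℕ with W ≥ d and W, L ≥ 60, every B ∈ ℝ_+ with B ≥ 1, and every ε ∈ (0, 1/2), the covering number of the class R(d,W,L,B) of ReLU network realizations satisfies log N(ε, R(d,W,L,B), L^p([0,1]^d)) ≥ c · W²L · log((W+1)^L B^L / ε). -/
open MeasureTheory ProbabilityTheory ENNReal

noncomputable section

section NetworkBuilding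

/-- Pre-activation values of a network whose hidden layers all have width `W`, with coefficients
indexed by natural numbers. -/
def preact {d : ℕ} (W : ℕ) (a : ℕ → ℕ → ℕ → ℝ) (b : ℕ → ℕ → ℝ) (x : Fin d → ℝ) :
    ℕ → ℕ → ℝ
  | 0, k => if h : k < d then x ⟨k, h⟩ else 0
  | i + 1, j =>
      (∑ k ∈ Finset.range (if i = 0 then d else W),
        a i j k * (if i = 0 then preact W a b x i k else max (preact W a b x i k) 0)) + b i j

lemma preact_congr {d W : ℕ} {a a' : ℕ → ℕ → ℕ → ℝ} {b b' : ℕ → ℕ → ℝ} (x : Fin d → ℝ)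
    (i : ℕ) (h : ∀ t < i, a t = a' t ∧ b t = b' t) :
    preact W a b x i = preact W a' b' x i := by
  induction i with
  | zero => rfl
  | succ i ih =>
    have ih' := ih fun t ht => h t (by omega)
    funext j
    simp only [preact, ih', (h i (by omega)).1, (h i (by omega)).2]

/-- The functions `x ↦ F x k` are, on the unit cube, among the pre-activations of layer `i` of a
network of width `W` and weight magnitude `B`. -/
def Computes {d : ℕ} (W : ℕ) (B : ℝ) (i : ℕ) {ι : Type} (F : (Fin d → ℝ) → ι → ℝ) : Prop :=
  ∃ (a : ℕ → ℕ → ℕ → ℝ) (b : ℕ → ℕ → ℝ), (∀ t j k, |a t j k| ≤ B) ∧ (∀ t j, |b t j| ≤ B) ∧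
    ∃ e : ι → ℕ, Function.Injective e ∧ (∀ k, e k < W) ∧
      ∀ x ∈ unitCube d, ∀ k, preact W a b x i (e k) = F x k

lemma abs_extend_le {ι : Type} {e : ι → ℕ} (he : Function.Injective e) {v : ι → ℝ} {B : ℝ}
    (hB : 0 ≤ B) (hv : ∀ k, |v k| ≤ B) (j : ℕ) : |Function.extend e v 0 j| ≤ B := by
  by_cases h : ∃ k, e k = j
  · obtain ⟨k, rfl⟩ := h
    rw [he.extend_apply]; exact hv k
  · rw [Function.extend_apply' _ _ _ h]; simpa using hB

lemma sum_extend_mul {ι : Type} [Fintype ι] {e : ι → ℕ} (he : Function.Injective e) {W : ℕ}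
    (hW : ∀ k, e k < W) (v : ι → ℝ) (g : ℕ → ℝ) :
    ∑ k ∈ Finset.range W, Function.extend e v 0 k * g k = ∑ k, v k * g (e k) := by
  symm
  refine Finset.sum_of_injOn e he.injOn (fun k _ => by simpa using hW k) ?_ ?_
  · intro j _ hj
    rw [Function.extend_apply' _ _ _ (by simpa using hj)]; simp
  · intro k _
    rw [he.extend_apply]

lemma exists_injective_lt {ι : Type} [Fintype ι] {W : ℕ} (h : Fintype.card ι ≤ W) :
    ∃ e : ι → ℕ, Function.Injective e ∧ ∀ k, e k < W :=
  ⟨fun k => (Fintype.equivFin ι k : ℕ),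
    fun _ _ h => (Fintype.equivFin ι).injective (Fin.ext h),
    fun k => (Fintype.equivFin ι k).2.trans_le h⟩

lemma Computes.input {d W : ℕ} {B : ℝ} (hd : 0 < d) (hB : 0 ≤ B) {ι : Type} [Fintype ι]
    (hι : Fintype.card ι ≤ W) (α β : ι → ℝ) (hα : ∀ k, |α k| ≤ B) (hβ : ∀ k, |β k| ≤ B) :
    Computes W B 1 (fun (x : Fin d → ℝ) k => α k * x ⟨0, hd⟩ + β k) := by
  obtain ⟨e, he, heW⟩ := exists_injective_lt hι
  refine ⟨fun _ j k => if k = 0 then Function.extend e α 0 j else 0,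
    fun _ j => Function.extend e β 0 j, ?_, fun _ j => abs_extend_le he hB hβ j, e, he, heW, ?_⟩
  · intro t j k
    dsimp only
    split_ifs
    · exact abs_extend_le he hB hα j
    · simpa using hB
  · intro x _ k
    simp only [preact, if_true, he.extend_apply]
    rw [Finset.sum_eq_single_of_mem 0 (by simpa using hd) fun t _ ht => by simp [ht]]
    simp [hd]

lemma Computes.step {d W i : ℕ} {B : ℝ} (hB : 0 ≤ B) (hi : i ≠ 0) {ι κ : Type}
    [Fintype ι] [Fintype κ]
    (hκ : Fintype.card κ ≤ W) {F : (Fin d → ℝ) → ι → ℝ} (hF : Computes W B i F)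
    (M : κ → ι → ℝ) (v : κ → ℝ) (hM : ∀ j k, |M j k| ≤ B) (hv : ∀ j, |v j| ≤ B)
    {G : (Fin d → ℝ) → κ → ℝ}
    (hG : ∀ x ∈ unitCube d, ∀ j, G x j = (∑ k, M j k * max (F x k) 0) + v j) :
    Computes W B (i + 1) G := by
  obtain ⟨a, b, ha, hb, e, he, heW, h⟩ := hF
  obtain ⟨e', he', heW'⟩ := exists_injective_lt hκ
  refine ⟨fun t j => if t = i then Function.extend e' (fun j => Function.extend e (M j) 0) 0 j
    else a t j, fun t j => if t = i then Function.extend e' v 0 j else b t j,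
    ?_, ?_, e', he', heW', ?_⟩
  · intro t j k
    dsimp only
    split_ifs
    · by_cases hj : ∃ j', e' j' = j
      · obtain ⟨j', rfl⟩ := hj
        rw [he'.extend_apply]
        exact abs_extend_le he hB (hM j') k
      · rw [Function.extend_apply' _ _ _ hj]; simpa using hB
    · exact ha t j k
  · intro t j
    dsimp only
    split_ifs
    · exact abs_extend_le he' hB hv j
    · exact hb t j
  · intro x hx j
    rw [hG x hx j]
    simp only [preact, hi, if_true, if_false, he'.extend_apply]
    congr 1
    rw [preact_congr (a' := a) (b' := b) x i
      (fun t ht => ⟨by funext j; simp [ht.ne], by funext j; simp [ht.ne]⟩)]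
    rw [sum_extend_mul he heW]
    exact Finset.sum_congr rfl fun k _ => by rw [h x hx k]

/-- The network with hidden widths `W` and naturally indexed coefficients. -/
def uniformNet (d W D : ℕ) (hD : 0 < D) (a : ℕ → ℕ → ℕ → ℝ) (b : ℕ → ℕ → ℝ) : ReLUNet d where
  depth := D
  depth_pos := hD
  width t := if t = 0 then d else if t = D then 1 else W
  width_in := by simp
  width_out := by simp [hD.ne']
  A t := fun j k => a t j k
  b t := fun j => b t j

lemma uniformNet_forward {d W D : ℕ} (hD : 0 < D) (a : ℕ → ℕ → ℕ → ℝ) (b : ℕ → ℕ → ℝ)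
    (x : Fin d → ℝ) (i : ℕ) (hi : i ≤ D) (j : Fin ((uniformNet d W D hD a b).width i)) :
    (uniformNet d W D hD a b).forward i
      (fun k => x (Fin.cast (uniformNet d W D hD a b).width_in k)) j = preact W a b x i j := by
  induction i with
  | zero =>
    have : (j : ℕ) < d := lt_of_lt_of_eq j.2 (by simp [uniformNet])
    simp only [ReLUNet.forward, preact, this, dif_pos]
    rfl
  | succ i ih =>
    have ih' := ih (by omega)
    have hw : (uniformNet d W D hD a b).width i = if i = 0 then d else W := by
      have : i ≠ D := by omega
      simp [uniformNet, this]
    simp only [ReLUNet.forward, ReLUNet.layer, preact, ih']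
    congr 1
    rw [← hw, Finset.sum_range]
    rfl

lemma Computes.mem_RclassB {d W i L : ℕ} {B : ℝ} (hi : i ≠ 0) (hdW : d ≤ W)
    (hW : 1 ≤ W) (hL : i ≤ L) {F : (Fin d → ℝ) → Unit → ℝ} (hF : Computes W B i F) :
    ∃ f ∈ RclassB d W L B, ∀ x ∈ unitCube d, f x = F x () := by
  obtain ⟨a, b, ha, hb, e, he, heW, h⟩ := hF
  have hi' : 0 < i := Nat.pos_of_ne_zero hi
  obtain ⟨i, rfl⟩ := Nat.exists_eq_succ_of_ne_zero hi
  set a' : ℕ → ℕ → ℕ → ℝ := fun t j k => if t = i then a t (e ()) k else a t j k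
  set b' : ℕ → ℕ → ℝ := fun t j => if t = i then b t (e ()) else b t j
  refine ⟨_, ⟨uniformNet d W (i + 1) hi' a' b', ?_, hL, ?_, rfl⟩, ?_⟩
  · intro t _
    simp only [uniformNet]
    split_ifs <;> omega
  · intro t _
    refine ⟨fun j k => ?_, fun j => ?_⟩
    · simp only [uniformNet, a']
      split_ifs <;> exact ha _ _ _
    · simp only [uniformNet, b']
      split_ifs <;> exact hb _ _
  · intro x hx
    rw [← h x hx ()]
    refine (uniformNet_forward hi' a' b' x (i + 1) le_rfl _).trans ?_
    simp only [preact]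
    rw [preact_congr (a' := a) (b' := b) x i
      (fun t ht => ⟨by funext j; simp [a', ht.ne], by funext j; simp [b', ht.ne]⟩)]
    simp [a', b']

lemma ReLUNet.continuous_realization {d : ℕ} (Φ : ReLUNet d) : Continuous Φ.realization := by
  have h : ∀ i, Continuous (Φ.forward i) := by
    intro i
    induction i with
    | zero => exact continuous_id
    | succ i ih =>
      refine continuous_pi fun j => ?_
      simp only [ReLUNet.forward, ReLUNet.layer]
      refine Continuous.add (continuous_finsetSum _ fun k _ => continuous_const.mul ?_)
        continuous_const
      split_ifs
      · exact (continuous_apply k).comp ih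
      · exact ((continuous_apply k).comp ih).max continuous_const
  exact (continuous_apply _).comp ((h _).comp (continuous_pi fun k => continuous_apply _))

end NetworkBuilding

section InterpolatingFunctions

/-- Slopes of the kinks of a zigzag function. -/
def zigzagCoeff (k : ℕ) : ℝ := if k = 0 then 1 / 2 else (-1) ^ k

lemma abs_zigzagCoeff_le (k : ℕ) : |zigzagCoeff k| ≤ 1 := by
  unfold zigzagCoeff
  split_ifs
  · norm_num
  · simp

/-- The function with slopes `±1/2` on the `n` consecutive intervals of length `1/K` starting at
`s/K`, vanishing at the left of `s/K`. -/
def zigzag (K : ℝ) (n : ℕ) (s x : ℝ) : ℝ :=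
  ∑ k : Fin n, zigzagCoeff k * max (x - (s + (k : ℕ)) / K) 0

lemma sum_zigzagCoeff (K y : ℝ) (j : ℕ) :
    ∑ k ∈ Finset.range (j + 1), zigzagCoeff k * (y - k / K) =
      if Even j then (y - j / K) / 2 else ((j + 1) / K - y) / 2 := by
  induction j with
  | zero => simp [zigzagCoeff]; ring
  | succ j ih =>
    rw [Finset.sum_range_succ, ih]
    have h0 : j + 1 ≠ 0 := by omega
    by_cases hj : Even j
    · have hj' : ¬ Even (j + 1) := by simpa [Nat.even_add_one] using hj
      simp only [hj, hj', if_true, if_false, zigzagCoeff, h0, pow_succ, hj.neg_one_pow]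
      push_cast; ring
    · have hj' : Even (j + 1) := by simpa [Nat.even_add_one] using hj
      simp only [hj, hj', if_true, if_false, zigzagCoeff, h0, hj'.neg_one_pow]
      push_cast; ring

lemma zigzag_eval {K : ℝ} (hK : 0 < K) {n : ℕ} {s x : ℝ} {j : ℕ} (hj : j < n)
    (h1 : (s + j) / K ≤ x) (h2 : x ≤ (s + j + 1) / K) :
    zigzag K n s x =
      if Even j then (x - (s + j) / K) / 2 else ((s + j + 1) / K - x) / 2 := by
  have h : zigzag K n s x =
      ∑ k ∈ Finset.range (j + 1), zigzagCoeff k * ((x - s / K) - k / K) := by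
    rw [zigzag, ← Finset.sum_range fun k => zigzagCoeff k * max (x - (s + (k : ℕ)) / K) 0]
    symm
    refine Finset.sum_subset_zero_on_sdiff (by simpa using hj) ?_ ?_
    · intro k hk
      have hk' : j + 1 ≤ k := by
        simp only [Finset.mem_sdiff, Finset.mem_range] at hk; omega
      have hk'' : (j : ℝ) + 1 ≤ k := by exact_mod_cast hk'
      have : (s + j + 1) / K ≤ (s + k) / K :=
        div_le_div_of_nonneg_right (by linarith) hK.le
      rw [max_eq_right (by linarith), mul_zero]
    · intro k hk
      have hk' : (k : ℝ) ≤ j := by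
        have := Finset.mem_range.1 hk
        exact_mod_cast Nat.lt_succ_iff.1 this
      have : (s + k) / K ≤ (s + j) / K := by gcongr
      rw [max_eq_left (by linarith), add_div]
      ring
  rw [h, sum_zigzagCoeff]
  split_ifs <;> ring

lemma abs_max_zero_sub_le (a b : ℝ) : |max a 0 - max b 0| ≤ |a - b| :=
  abs_max_sub_max_le_abs a b 0

lemma abs_zigzag_sub_le (K : ℝ) (n : ℕ) (s x y : ℝ) :
    |zigzag K n s x - zigzag K n s y| ≤ n * |x - y| := by
  rw [zigzag, zigzag, ← Finset.sum_sub_distrib]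
  refine (Finset.abs_sum_le_sum_abs _ _).trans ?_
  refine (Finset.sum_le_sum (g := fun _ => |x - y|) fun k _ => ?_).trans (by simp)
  rw [← mul_sub, abs_mul]
  refine (mul_le_of_le_one_left (abs_nonneg _) (abs_zigzagCoeff_le k)).trans ?_
  refine (abs_max_zero_sub_le _ _).trans (le_of_eq ?_)
  congr 1; ring

lemma zigzag_le {K : ℝ} (hK : 0 < K) (n : ℕ) {s x : ℝ} (hs : 0 ≤ s) (hx : x ≤ 1) :
    zigzag K n s x ≤ n := by
  rw [zigzag]
  refine (Finset.sum_le_sum (g := fun _ => (1 : ℝ)) fun k _ => ?_).trans (by simp)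
  refine (le_abs_self _).trans ?_
  rw [abs_mul, abs_of_nonneg (le_max_right (x - (s + (k : ℕ)) / K) 0)]
  refine (mul_le_of_le_one_left (le_max_right _ _) (abs_zigzagCoeff_le k)).trans ?_
  have : 0 ≤ (s + (k : ℕ)) / K := by positivity
  exact max_le (by linarith) zero_le_one

/-- The contribution of the cell with left endpoint `(s + j) / K`: a combination of shifted
rectified zigzags, switched off at the left of the cell. -/
def cellTerm (K h : ℝ) {n : ℕ} (M : Fin n → ℝ) (s : ℝ) (j : ℕ) (x : ℝ) : ℝ :=
  max (∑ i : Fin n, M i * max (zigzag K n s x - (i : ℕ) * h) 0 - max ((s + j) / K - x) 0) 0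

lemma abs_cellTerm_sub_le (K h : ℝ) {n : ℕ} {M : Fin n → ℝ} {u : ℝ} (hM0 : ∀ i, 0 ≤ M i)
    (hM : ∀ i, M i ≤ u) (hu : n * (u * n) ≤ 1) (s : ℝ) (j : ℕ) (x y : ℝ) :
    |cellTerm K h M s j x - cellTerm K h M s j y| ≤ 2 * |x - y| := by
  refine (abs_max_zero_sub_le _ _).trans ?_
  have h1 : |(∑ i : Fin n, M i * max (zigzag K n s x - (i : ℕ) * h) 0) -
      ∑ i : Fin n, M i * max (zigzag K n s y - (i : ℕ) * h) 0| ≤ |x - y| := by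
    rw [← Finset.sum_sub_distrib]
    refine (Finset.abs_sum_le_sum_abs _ _).trans ?_
    refine (Finset.sum_le_sum (g := fun _ => u * n * |x - y|) fun i _ => ?_).trans ?_
    · rw [← mul_sub, abs_mul, abs_of_nonneg (hM0 i), mul_assoc]
      refine mul_le_mul (hM i) ?_ (abs_nonneg _) ((hM0 i).trans (hM i))
      refine (abs_max_zero_sub_le _ _).trans ?_
      rw [sub_sub_sub_cancel_right]
      exact abs_zigzag_sub_le K n s x y
    · rw [Finset.sum_const, Finset.card_univ, Fintype.card_fin, nsmul_eq_mul, ← mul_assoc]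
      exact mul_le_of_le_one_left (abs_nonneg _) hu
  have h2 : |max ((s + j) / K - x) 0 - max ((s + j) / K - y) 0| ≤ |x - y| := by
    refine (abs_max_zero_sub_le _ _).trans (le_of_eq ?_)
    rw [abs_sub_comm x y]
    congr 1; ring
  calc _ = |((∑ i : Fin n, M i * max (zigzag K n s x - (i : ℕ) * h) 0) -
      ∑ i : Fin n, M i * max (zigzag K n s y - (i : ℕ) * h) 0) -
        (max ((s + j) / K - x) 0 - max ((s + j) / K - y) 0)| := by congr 1; ring
    _ ≤ _ := abs_sub _ _
    _ ≤ _ := by linarith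

lemma cellTerm_eq_zero {K h : ℝ} (hK : 0 < K) (hh : 0 ≤ h) {n : ℕ} {M : Fin n → ℝ} {u : ℝ}
    (hM0 : ∀ i, 0 ≤ M i) (hM : ∀ i, M i ≤ u) {s x : ℝ} (hs : 0 ≤ s) (hx : x ≤ 1) {j : ℕ}
    (hj : x + n * (u * n) ≤ (s + j) / K) : cellTerm K h M s j x = 0 := by
  refine max_eq_right ?_
  have h1 : ∑ i : Fin n, M i * max (zigzag K n s x - (i : ℕ) * h) 0 ≤ n * (u * n) := by
    refine (Finset.sum_le_sum (g := fun _ => u * n) fun i _ => ?_).trans (by simp)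
    refine mul_le_mul (hM i) (max_le ?_ n.cast_nonneg) (le_max_right _ _) ((hM0 i).trans (hM i))
    have := zigzag_le hK n hs hx
    have : 0 ≤ (i : ℕ) * h := by positivity
    linarith
  have := le_max_left ((s + j) / K - x) 0
  linarith

/-- The sum of the contributions of the cells in the first `l` blocks of `n` cells. -/
def cellSum (K h : ℝ) {n : ℕ} (M : ℕ → Fin n → Fin n → ℝ) (l : ℕ) (x : ℝ) : ℝ :=
  ∑ t ∈ Finset.range l, ∑ j : Fin n, cellTerm K h (M t j) (t * n) j x

lemma cellSum_nonneg (K h : ℝ) {n : ℕ} (M : ℕ → Fin n → Fin n → ℝ) (l : ℕ) (x : ℝ) :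
    0 ≤ cellSum K h M l x :=
  Finset.sum_nonneg fun _ _ => Finset.sum_nonneg fun _ _ => le_max_right _ _

lemma abs_cellSum_sub_le (K h : ℝ) {n : ℕ} {M : ℕ → Fin n → Fin n → ℝ} {u : ℝ}
    (hM0 : ∀ t j i, 0 ≤ M t j i) (hM : ∀ t j i, M t j i ≤ u) (hu : n * (u * n) ≤ 1) (l : ℕ)
    (x y : ℝ) : |cellSum K h M l x - cellSum K h M l y| ≤ 2 * (n * l) * |x - y| := by
  rw [cellSum, cellSum, ← Finset.sum_sub_distrib]
  refine (Finset.abs_sum_le_sum_abs _ _).trans ?_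
  refine (Finset.sum_le_sum (g := fun _ => n * (2 * |x - y|)) fun t _ => ?_).trans
    (le_of_eq (by simp; ring))
  rw [← Finset.sum_sub_distrib]
  refine (Finset.abs_sum_le_sum_abs _ _).trans ?_
  exact (Finset.sum_le_sum (g := fun _ => 2 * |x - y|) fun j _ =>
    abs_cellTerm_sub_le K h (hM0 t j) (hM t j) hu _ _ x y).trans (by simp)

lemma cellTerm_sub_cellTerm {K h : ℝ} (hh : 0 ≤ h) {n : ℕ} {M M' : Fin n → ℝ}
    (hM0 : ∀ i, 0 ≤ M i) (hM0' : ∀ i, 0 ≤ M' i) {s x : ℝ} {j : ℕ} (hx : (s + j) / K ≤ x)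
    {i₀ : Fin n} (hz : zigzag K n s x = ((i₀ : ℕ) + 1) * h) (hi : ∀ i < i₀, M i = M' i) :
    cellTerm K h M s j x - cellTerm K h M' s j x = (M i₀ - M' i₀) * h := by
  have key : ∀ N : Fin n → ℝ, (∀ i, 0 ≤ N i) → cellTerm K h N s j x =
      ∑ i : Fin n, N i * max (((i₀ : ℕ) + 1) * h - (i : ℕ) * h) 0 := by
    intro N hN
    rw [cellTerm, hz, max_eq_right (by linarith : (s + j) / K - x ≤ 0), sub_zero]
    exact max_eq_left (Finset.sum_nonneg fun i _ => mul_nonneg (hN i) (le_max_right _ _))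
  rw [key M hM0, key M' hM0', ← Finset.sum_sub_distrib]
  rw [Finset.sum_eq_single i₀]
  · rw [max_eq_left (by linarith)]; ring
  · intro i _ hne
    rcases lt_or_gt_of_ne hne with hlt | hgt
    · rw [hi i hlt]; ring
    · have : ((i₀ : ℕ) : ℝ) + 1 ≤ (i : ℕ) := by exact_mod_cast hgt
      rw [max_eq_right (by nlinarith)]; ring
  · simp

lemma exists_cellSum_sub_eq {n m : ℕ} {K h u : ℝ} (hK : K = n * m)
    (hh : h = 1 / (2 * K * (n + 1))) (hu : n * (u * n) ≤ h)
    {M M' : ℕ → Fin n → Fin n → ℝ}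
    (hM0 : ∀ t j i, 0 ≤ M t j i) (hM : ∀ t j i, M t j i ≤ u)
    (hM0' : ∀ t j i, 0 ≤ M' t j i) (hM' : ∀ t j i, M' t j i ≤ u)
    {l : ℕ} {j₀ i₀ : Fin n} (hl : l < m) (h1 : ∀ t < l, M t = M' t)
    (h2 : ∀ j < j₀, M l j = M' l j) (h3 : ∀ i < i₀, M l j₀ i = M' l j₀ i) :
    ∃ x, 2 * h ≤ x ∧ x ≤ 1 - 2 * h ∧
      cellSum K h M m x - cellSum K h M' m x = (M l j₀ i₀ - M' l j₀ i₀) * h := by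
  have hn : 0 < n := i₀.pos
  have hm : 0 < m := by omega
  have hnR : (0 : ℝ) < n := by exact_mod_cast hn
  have hmR : (0 : ℝ) < m := by exact_mod_cast hm
  have hK0 : 0 < K := by rw [hK]; positivity
  have hh0 : 0 < h := by rw [hh]; positivity
  have hcell : 2 * (n + 1) * h = 1 / K := by rw [hh]; field_simp
  have hi : ((i₀ : ℕ) : ℝ) + 1 ≤ n := by exact_mod_cast i₀.2
  have hi' : (0 : ℝ) ≤ (i₀ : ℕ) := by positivity
  set s : ℝ := l * n with hs
  have hs0 : 0 ≤ s := by positivity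
  have hnext : (s + (j₀ : ℕ) + 1) / K = (s + (j₀ : ℕ)) / K + 1 / K := by ring
  obtain ⟨x, hx1, hx2, hz⟩ : ∃ x, (s + (j₀ : ℕ)) / K + 2 * h ≤ x ∧
      x ≤ (s + (j₀ : ℕ) + 1) / K - 2 * h ∧ zigzag K n s x = ((i₀ : ℕ) + 1) * h := by
    by_cases hj : Even (j₀ : ℕ)
    · refine ⟨(s + (j₀ : ℕ)) / K + 2 * ((i₀ : ℕ) + 1) * h, by nlinarith, ?_, ?_⟩
      · rw [hnext]; nlinarith
      · rw [zigzag_eval hK0 j₀.2 (le_add_of_nonneg_right (by positivity))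
          (by rw [hnext]; nlinarith), if_pos hj]
        ring
    · refine ⟨(s + (j₀ : ℕ) + 1) / K - 2 * ((i₀ : ℕ) + 1) * h, ?_, by nlinarith, ?_⟩
      · rw [hnext]; nlinarith
      · rw [zigzag_eval hK0 j₀.2 (by rw [hnext]; nlinarith)
          (sub_le_self _ (by positivity)), if_neg hj]
        ring
  have hlast : (s + (j₀ : ℕ) + 1) / K ≤ 1 := by
    rw [div_le_one hK0, hK, hs]
    have e1 : ((j₀ : ℕ) : ℝ) + 1 ≤ n := by exact_mod_cast j₀.2
    have e2 : (l : ℝ) + 1 ≤ m := by exact_mod_cast hl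
    nlinarith
  have hfirst : 0 ≤ (s + (j₀ : ℕ)) / K := by positivity
  have hx1' : x ≤ 1 := by linarith
  have hlater : ∀ (t : ℕ) (j : Fin n), l * n + j₀ + 1 ≤ t * n + j →
      cellTerm K h (M t j) (t * n) j x - cellTerm K h (M' t j) (t * n) j x = 0 := by
    intro t j htj
    have e1 : s + (j₀ : ℕ) + 1 ≤ (t : ℝ) * n + (j : ℕ) := by
      rw [hs]; exact_mod_cast htj
    have e2 : (s + (j₀ : ℕ) + 1) / K ≤ ((t : ℝ) * n + (j : ℕ)) / K := by gcongr
    have e3 : x + n * (u * n) ≤ ((t : ℝ) * n + (j : ℕ)) / K := by linarith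
    rw [cellTerm_eq_zero hK0 hh0.le (hM0 t j) (hM t j) (by positivity) hx1' e3,
      cellTerm_eq_zero hK0 hh0.le (hM0' t j) (hM' t j) (by positivity) hx1' e3, sub_zero]
  refine ⟨x, by linarith, by linarith, ?_⟩
  rw [cellSum, cellSum, ← Finset.sum_sub_distrib, Finset.sum_eq_single l,
    ← Finset.sum_sub_distrib, Finset.sum_eq_single j₀]
  · exact cellTerm_sub_cellTerm hh0.le (hM0 _ _) (hM0' _ _) (by linarith) hz h3
  · intro j _ hne
    rcases lt_or_gt_of_ne hne with hlt | hgt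
    · rw [h2 j hlt, sub_self]
    · exact hlater l j (by have : (j₀ : ℕ) < j := hgt; omega)
  · simp
  · intro t _ hne
    rw [← Finset.sum_sub_distrib]
    rcases lt_or_gt_of_ne hne with hlt | hgt
    · simp [h1 t hlt]
    · refine Finset.sum_eq_zero fun j _ => hlater t j ?_
      have e1 : (l + 1) * n ≤ t * n := Nat.mul_le_mul_right n hgt
      have e2 := j₀.2
      rw [add_mul, one_mul] at e1
      omega
  · intro h; exact absurd (Finset.mem_range.2 hl) h

end InterpolatingFunctions

section NetworkOfCells

/-- The values stored between two blocks: the input, the running sum, and shifted copies of the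
input. -/
def blockState {d n : ℕ} (hd : 0 < d) (g : ℝ → ℝ) (c : Fin n → ℝ) (x : Fin d → ℝ) :
    (Unit ⊕ Unit) ⊕ Fin n → ℝ :=
  Sum.elim (Sum.elim (fun _ => x ⟨0, hd⟩) fun _ => g (x ⟨0, hd⟩)) fun k => x ⟨0, hd⟩ - c k

lemma coord_mem_Icc {d : ℕ} {x : Fin d → ℝ} (hx : x ∈ unitCube d) (i : Fin d) :
    0 ≤ x i ∧ x i ≤ 1 := hx i (Set.mem_univ i)

lemma computes_cellSum_succ {d W n i l : ℕ} {B K h : ℝ} (hd : 0 < d) (hB : 1 ≤ B) (hi : i ≠ 0)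
    (hW : 2 * n + 2 ≤ W) (hh0 : 0 ≤ h) (hnh : n * h ≤ 1)
    {M : ℕ → Fin n → Fin n → ℝ} (hM0 : ∀ t j i, 0 ≤ M t j i) (hM : ∀ t j i, M t j i ≤ 1)
    (hthr : ∀ k : Fin n, |((l : ℝ) * n + (k : ℕ)) / K| ≤ 1)
    (hstate : Computes W B i (blockState hd (cellSum K h M l)
      fun k : Fin n => ((l : ℝ) * n + (k : ℕ)) / K))
    (c : Fin n → ℝ) (hc : ∀ k, |c k| ≤ 1) :
    Computes W B (i + 3) (blockState hd (cellSum K h M (l + 1)) c) := by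
  have hB0 : 0 ≤ B := by linarith
  have s1 : Computes W B (i + 1) (fun x : Fin d → ℝ =>
      (Sum.elim (Sum.elim (fun _ => x ⟨0, hd⟩) fun _ => cellSum K h M l (x ⟨0, hd⟩))
        (Sum.elim (fun k => zigzag K n (l * n) (x ⟨0, hd⟩) - (k : ℕ) * h)
          fun j => ((l : ℝ) * n + (j : ℕ)) / K - x ⟨0, hd⟩) :
        (Unit ⊕ Unit) ⊕ (Fin n ⊕ Fin n) → ℝ)) := by
    refine hstate.step (κ := (Unit ⊕ Unit) ⊕ (Fin n ⊕ Fin n)) hB0 hi (by simp; omega)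
      (Sum.elim (Sum.elim (fun _ => Sum.elim (Sum.elim 1 0) 0) fun _ => Sum.elim (Sum.elim 0 1) 0)
        (Sum.elim (fun _ => Sum.elim 0 fun k => zigzagCoeff k)
          fun _ => Sum.elim (Sum.elim (-1) 0) 0))
      (Sum.elim 0 (Sum.elim (fun k => -((k : ℕ) * h)) fun j => ((l : ℝ) * n + (j : ℕ)) / K))
      ?_ ?_ ?_
    · rintro ((_ | _) | _ | _) ((_ | _) | k) <;> simp [hB0, hB]
      exact (abs_zigzagCoeff_le k).trans hB
    · rintro ((_ | _) | k | j)
      · simpa using hB0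
      · simpa using hB0
      · simp only [Sum.elim_inr, Sum.elim_inl, abs_neg]
        rw [abs_of_nonneg (by positivity)]
        have : ((k : ℕ) : ℝ) ≤ n := by exact_mod_cast k.2.le
        nlinarith
      · simpa using (hthr j).trans hB
    · intro x hx j
      have hx0 := (coord_mem_Icc hx ⟨0, hd⟩).1
      have hacc := cellSum_nonneg K h M l (x ⟨0, hd⟩)
      rcases j with (_ | _) | k | j <;> simp [blockState, hx0, hacc, zigzag]
      all_goals ring
  have s2 : Computes W B (i + 2) (fun x : Fin d → ℝ =>
      (Sum.elim (Sum.elim (fun _ => x ⟨0, hd⟩) fun _ => cellSum K h M l (x ⟨0, hd⟩))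
        (fun j => ∑ i : Fin n, M l j i * max (zigzag K n (l * n) (x ⟨0, hd⟩) - (i : ℕ) * h) 0 -
          max (((l : ℝ) * n + (j : ℕ)) / K - x ⟨0, hd⟩) 0) :
        (Unit ⊕ Unit) ⊕ Fin n → ℝ)) := by
    refine s1.step hB0 (by omega) (by simp; omega)
      (Sum.elim (Sum.elim (fun _ => Sum.elim (Sum.elim 1 0) 0) fun _ => Sum.elim (Sum.elim 0 1) 0)
        (fun j => Sum.elim 0 (Sum.elim (M l j) fun j' => if j = j' then -1 else 0))) 0
      ?_ ?_ ?_
    · rintro ((_ | _) | j) ((_ | _) | k | j') <;> simp [hB0, hB]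
      · rw [abs_of_nonneg (hM0 _ _ _)]; exact (hM _ _ _).trans hB
      · split_ifs <;> simp [hB0, hB]
    · intro j; simpa using hB0
    · intro x hx j
      have hx0 := (coord_mem_Icc hx ⟨0, hd⟩).1
      have hacc := cellSum_nonneg K h M l (x ⟨0, hd⟩)
      rcases j with (_ | _) | j <;> simp [hx0, hacc]
      ring
  refine s2.step hB0 (by omega) (by simp; omega)
    (Sum.elim (Sum.elim (fun _ => Sum.elim (Sum.elim 1 0) 0) fun _ => Sum.elim (Sum.elim 0 1) 1)
      (fun _ => Sum.elim (Sum.elim 1 0) 0)) (Sum.elim 0 fun k => -c k)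
    ?_ ?_ ?_
  · rintro ((_ | _) | j) ((_ | _) | k) <;> simp [hB0, hB]
  · rintro ((_ | _) | k) <;> simp [hB0]
    exact (hc k).trans hB
  · intro x hx j
    have hx0 := (coord_mem_Icc hx ⟨0, hd⟩).1
    have hacc := cellSum_nonneg K h M l (x ⟨0, hd⟩)
    rcases j with (_ | _) | j <;> simp [hx0, hacc, blockState]
    · simp [cellSum, Finset.sum_range_succ, cellTerm]
    · ring

lemma computes_cellSum {d W n m : ℕ} {B K h : ℝ} (hd : 0 < d) (hB : 1 ≤ B)
    (hW : 2 * n + 2 ≤ W) (hK : K = n * m) (hh0 : 0 ≤ h) (hnh : n * h ≤ 1)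
    {M : ℕ → Fin n → Fin n → ℝ} (hM0 : ∀ t j i, 0 ≤ M t j i) (hM : ∀ t j i, M t j i ≤ 1)
    (l : ℕ) (hl : l ≤ m) (c : Fin n → ℝ) (hc : ∀ k, |c k| ≤ 1) :
    Computes W B (3 * l + 1) (blockState hd (cellSum K h M l) c) := by
  have hB0 : 0 ≤ B := by linarith
  induction l generalizing c with
  | zero =>
    have h1 := Computes.input hd hB0 (W := W) (ι := (Unit ⊕ Unit) ⊕ Fin n) (by simp; omega)
      (Sum.elim (Sum.elim 1 0) 1) (Sum.elim 0 fun k => -c k)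
      (by rintro ((_ | _) | k) <;> simp [hB0, hB])
      (by rintro ((_ | _) | k) <;> simp [hB0]; exact (hc k).trans hB)
    convert h1 using 1
    funext x j
    rcases j with (_ | _) | j <;> simp [blockState, cellSum]
    ring
  | succ l ih =>
    have hthr : ∀ k : Fin n, |((l : ℝ) * n + (k : ℕ)) / K| ≤ 1 := by
      intro k
      have hn : (0 : ℝ) < n := by exact_mod_cast k.pos
      have hm : (0 : ℝ) < m := by exact_mod_cast (by omega : 0 < m)
      have e1 : ((k : ℕ) : ℝ) ≤ n := by exact_mod_cast k.2.le
      have e2 : (l : ℝ) + 1 ≤ m := by exact_mod_cast hl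
      rw [abs_of_nonneg (by rw [hK]; positivity), hK, div_le_one (by positivity)]
      nlinarith
    exact computes_cellSum_succ hd hB (by omega) hW hh0 hnh hM0 hM hthr
      (ih (by omega) _ hthr) c hc

lemma Computes.amplify {d W i : ℕ} {B : ℝ} (hB : 0 ≤ B) (hi : i ≠ 0) {g : (Fin d → ℝ) → ℝ}
    (hg : ∀ x, 0 ≤ g x) (h : Computes W B i fun x (_ : Fin W) => g x) (q : ℕ) :
    Computes W B (i + q) fun x (_ : Fin W) => (W * B) ^ q * g x := by
  induction q with
  | zero => simpa using h
  | succ q ih =>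
    refine ih.step hB (by omega) (by simp) (fun _ _ => B) 0 (fun _ _ => (abs_of_nonneg hB).le)
      (fun _ => by simpa using hB) fun x _ j => ?_
    have : 0 ≤ (W * B) ^ q * g x := mul_nonneg (by positivity) (hg x)
    simp [this]
    ring

lemma exists_mem_RclassB_eq_cellSum {d W n m q L : ℕ} {B K h : ℝ} (hd : 0 < d) (hdW : d ≤ W)
    (hB : 1 ≤ B) (hW : 2 * n + 2 ≤ W) (hL : 3 * m + q + 3 ≤ L) (hK : K = n * m) (hh0 : 0 ≤ h)
    (hnh : n * h ≤ 1)
    {M : ℕ → Fin n → Fin n → ℝ} (hM0 : ∀ t j i, 0 ≤ M t j i) (hM : ∀ t j i, M t j i ≤ 1) :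
    ∃ f ∈ RclassB d W L B, ∀ x ∈ unitCube d,
      f x = (W * B) ^ (q + 1) * cellSum K h M m (x ⟨0, hd⟩) := by
  have hB0 : 0 ≤ B := by linarith
  have hacc := fun x : Fin d → ℝ => cellSum_nonneg K h M m (x ⟨0, hd⟩)
  have s1 : Computes W B (3 * m + 1 + 1) fun x (_ : Fin W) => cellSum K h M m (x ⟨0, hd⟩) := by
    refine (computes_cellSum hd hB hW hK hh0 hnh hM0 hM m le_rfl 0 (by simp)).step hB0 (by omega)
      (by simp) (fun _ => Sum.elim (Sum.elim 0 1) 0) 0 ?_ (fun _ => by simpa using hB0) ?_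
    · rintro _ ((_ | _) | _) <;> simp [hB0, hB]
    · intro x _ _
      simp [blockState, hacc]
  have s2 := s1.amplify hB0 (by omega) hacc q
  have s3 : Computes W B (3 * m + 1 + 1 + q + 1)
      fun x (_ : Unit) => (W * B) ^ (q + 1) * cellSum K h M m (x ⟨0, hd⟩) := by
    refine s2.step hB0 (by omega) (by simp; omega) (fun _ _ => B) 0
      (fun _ _ => (abs_of_nonneg hB0).le) (fun _ => by simpa using hB0) fun x _ j => ?_
    have : 0 ≤ (W * B) ^ q * cellSum K h M m (x ⟨0, hd⟩) :=
      mul_nonneg (by positivity) (hacc x)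
    simp [this]
    ring
  exact s3.mem_RclassB (by omega) hdW (by omega) (by omega)

end NetworkOfCells

section Packing

instance isProbabilityMeasure_unitCube (d : ℕ) :
    IsProbabilityMeasure ((volume : Measure (Fin d → ℝ)).restrict (unitCube d)) := by
  refine ⟨?_⟩
  rw [Measure.restrict_apply_univ, unitCube, volume_pi_pi]
  simp

lemma continuous_of_mem_RclassB {d W L : ℕ} {B : ℝ} {f : (Fin d → ℝ) → ℝ}
    (hf : f ∈ RclassB d W L B) : Continuous f := by
  obtain ⟨Φ, -, -, -, rfl⟩ := hf
  exact Φ.continuous_realization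

lemma volume_slab {d : ℕ} (hd : 0 < d) {u v : ℝ} (hu : 0 ≤ u) (hv : v ≤ 1) :
    (volume.restrict (unitCube d)) {x : Fin d → ℝ | x ⟨0, hd⟩ ∈ Set.Icc u v} =
      ENNReal.ofReal (v - u) := by
  have hms : MeasurableSet {x : Fin d → ℝ | x ⟨0, hd⟩ ∈ Set.Icc u v} :=
    (measurable_pi_apply _) measurableSet_Icc
  have hset : {x : Fin d → ℝ | x ⟨0, hd⟩ ∈ Set.Icc u v} ∩ unitCube d =
      Set.univ.pi fun i : Fin d => if i = ⟨0, hd⟩ then Set.Icc u v else Set.Icc (0 : ℝ) 1 := by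
    ext x
    simp only [unitCube, Set.mem_inter_iff, Set.mem_ofPred_eq, Set.mem_univ_pi]
    constructor
    · rintro ⟨h1, h2⟩ i
      split_ifs with hi
      · rw [hi]; exact h1
      · exact h2 i
    · intro h
      have h0 := h ⟨0, hd⟩
      rw [if_pos rfl] at h0
      refine ⟨h0, fun i => ?_⟩
      by_cases hi : i = ⟨0, hd⟩
      · rw [hi]; exact ⟨hu.trans h0.1, h0.2.trans hv⟩
      · have := h i
        rwa [if_neg hi] at this
  rw [Measure.restrict_apply hms, hset, volume_pi_pi,
    Finset.prod_eq_single (⟨0, hd⟩ : Fin d) (fun i _ hi => by simp [hi]) (by simp)]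
  simp

lemma ofReal_mul_le_cubeDist {d : ℕ} (hd : 0 < d) {p : ℝ≥0∞} (hp : 1 ≤ p)
    {f g : (Fin d → ℝ) → ℝ} (hf : Continuous f) (hg : Continuous g) {u v c : ℝ}
    (hu : 0 ≤ u) (hv : v ≤ 1) (hc : 0 ≤ c)
    (h : ∀ x ∈ unitCube d, x ⟨0, hd⟩ ∈ Set.Icc u v → c ≤ |f x - g x|) :
    ENNReal.ofReal (c * (v - u)) ≤ cubeDist d p f g := by
  have hmeas : AEStronglyMeasurable (f - g) (volume.restrict (unitCube d)) :=
    (hf.sub hg).aestronglyMeasurable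
  refine le_trans ?_ (eLpNorm_le_eLpNorm_of_exponent_le hp hmeas)
  rw [eLpNorm_one_eq_lintegral_enorm, ENNReal.ofReal_mul hc, ← volume_slab hd hu hv]
  have hms : MeasurableSet {x : Fin d → ℝ | x ⟨0, hd⟩ ∈ Set.Icc u v} :=
    (measurable_pi_apply _) measurableSet_Icc
  have hcube : MeasurableSet (unitCube d) :=
    MeasurableSet.pi Set.countable_univ fun _ _ => measurableSet_Icc
  rw [← lintegral_indicator_const hms]
  refine lintegral_mono_ae ?_
  filter_upwards [ae_restrict_mem hcube] with x hx
  by_cases hxs : x ∈ {x : Fin d → ℝ | x ⟨0, hd⟩ ∈ Set.Icc u v}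
  · rw [Set.indicator_of_mem hxs, ← ofReal_norm]
    exact ENNReal.ofReal_le_ofReal (h x hx hxs)
  · rw [Set.indicator_of_notMem hxs]; exact zero_le

lemma card_le_card_of_separated {d W L : ℕ} {B ε : ℝ} {p : ℝ≥0∞} (hp : 1 ≤ p) (hε : 0 ≤ ε)
    {T : Type*} [Fintype T] (f : T → (Fin d → ℝ) → ℝ) (hf : ∀ θ, f θ ∈ RclassB d W L B)
    (hsep : ∀ θ θ', θ ≠ θ' → ENNReal.ofReal (2 * ε) < cubeDist d p (f θ) (f θ'))
    (C : Finset ((Fin d → ℝ) → ℝ)) (hC : ↑C ⊆ RclassB d W L B)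
    (hcov : ∀ g ∈ RclassB d W L B, ∃ c ∈ C, cubeDist d p g c ≤ ENNReal.ofReal ε) :
    Fintype.card T ≤ C.card := by
  choose c hcC hc using fun θ => hcov (f θ) (hf θ)
  rw [← Finset.card_univ]
  refine Finset.card_le_card_of_injOn c (fun θ _ => hcC θ) fun θ _ θ' _ heq => ?_
  by_contra hne
  refine (hsep θ θ' hne).not_ge ?_
  have hcont : ∀ θ, Continuous (f θ) := fun θ => continuous_of_mem_RclassB (hf θ)
  have hcc : Continuous (c θ) := continuous_of_mem_RclassB (hC (hcC θ))
  have h1 := hc θ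
  have h2 := hc θ'
  rw [← heq] at h2
  unfold cubeDist at h1 h2 ⊢
  calc eLpNorm (f θ - f θ') p _
      = eLpNorm ((f θ - c θ) - (f θ' - c θ)) p (volume.restrict (unitCube d)) := by
        rw [sub_sub_sub_cancel_right]
    _ ≤ _ := eLpNorm_sub_le ((hcont θ).sub hcc).aestronglyMeasurable
        ((hcont θ').sub hcc).aestronglyMeasurable hp
    _ ≤ ENNReal.ofReal ε + ENNReal.ofReal ε := add_le_add h1 h2
    _ = ENNReal.ofReal (2 * ε) := by rw [← ENNReal.ofReal_add hε hε, two_mul]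

lemma ofReal_le_elog2_coveringNumber {α : Type*} {ε : ℝ≥0∞} {X : Set α} {δ : α → α → ℝ≥0∞}
    {N : ℕ} (hN : 0 < N) {r : ℝ} (hr : r ≤ Real.logb 2 N)
    (h : ∀ C : Finset α, ↑C ⊆ X → (∀ x ∈ X, ∃ c ∈ C, δ x c ≤ ε) → N ≤ C.card) :
    ENNReal.ofReal r ≤ elog2 (coveringNumber ε X δ) := by
  unfold elog2
  split_ifs with htop
  · exact le_top
  · have hne : {n : ℕ∞ | ∃ C : Finset α, ↑C ⊆ X ∧ (∀ x ∈ X, ∃ c ∈ C, δ x c ≤ ε) ∧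
        (C.card : ℕ∞) = n}.Nonempty := by
      by_contra hempty
      rw [Set.not_nonempty_iff_eq_empty] at hempty
      exact htop (by rw [coveringNumber, hempty, sInf_empty])
    obtain ⟨C, hCX, hcov, hcard⟩ := csInf_mem hne
    have hcard' : (coveringNumber ε X δ).toNat = C.card := by
      rw [coveringNumber, ← hcard, ENat.toNat_natCast]
    rw [hcard']
    refine ENNReal.ofReal_le_ofReal (hr.trans ?_)
    exact Real.logb_le_logb_of_le one_lt_two (by exact_mod_cast hN)
      (by exact_mod_cast h C hCX hcov)

lemma exists_first_ne {k : ℕ} {α : Type*} {f g : Fin k → α} (h : f ≠ g) :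
    ∃ i, f i ≠ g i ∧ ∀ i' < i, f i' = g i' := by
  obtain ⟨i, hi⟩ := Function.ne_iff.1 h
  obtain ⟨i, hi, hmin⟩ := WellFounded.has_min (wellFounded_lt (α := Fin k)) {i | f i ≠ g i} ⟨i, hi⟩
  exact ⟨i, hi, fun i' hi' => by_contra fun hne => hmin i' hne hi'⟩

end Packing

section LowerBound

lemma pow_card_le_card_of_covering {d W L n m q Q : ℕ} {B ε : ℝ} {p : ℝ≥0∞} (hp : 1 ≤ p)
    (hd : 0 < d) (hdW : d ≤ W) (hB : 1 ≤ B) (hε : 0 ≤ ε) (hn : 0 < n) (hm : 0 < m) (hQ : 0 < Q)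
    (hW : 2 * n + 2 ≤ W) (hL : 3 * m + q + 3 ≤ L)
    (hgap : 256 * ((n : ℝ) * m) ^ 5 * (n + 1) ^ 4 * n ^ 4 * Q ^ 2 * ε < (W * B) ^ (q + 1))
    (C : Finset ((Fin d → ℝ) → ℝ)) (hC : ↑C ⊆ RclassB d W L B)
    (hcov : ∀ g ∈ RclassB d W L B, ∃ c ∈ C, cubeDist d p g c ≤ ENNReal.ofReal ε) :
    (Q + 1) ^ (m * n ^ 2) ≤ C.card := by
  have hnR : (1 : ℝ) ≤ n := by exact_mod_cast hn
  have hmR : (1 : ℝ) ≤ m := by exact_mod_cast hm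
  have hQR : (1 : ℝ) ≤ Q := by exact_mod_cast hQ
  set K : ℝ := n * m with hK
  have hK1 : 1 ≤ K := one_le_mul_of_one_le_of_one_le hnR hmR
  have hnK : (n : ℝ) ≤ K := le_mul_of_one_le_right (by linarith) hmR
  obtain ⟨h, hh⟩ : ∃ h : ℝ, h = 1 / (2 * K * (n + 1)) := ⟨_, rfl⟩
  have hh0 : 0 < h := by rw [hh]; positivity
  have hnh : n * h ≤ 1 := by
    rw [hh, mul_one_div, div_le_one (by positivity)]; nlinarith
  have hh1 : h ≤ 1 := by nlinarith
  set μ : ℝ := h / (n ^ 2 * Q) with hμ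
  have hμ0 : 0 < μ := by positivity
  have hμ1 : μ ≤ 1 := by
    rw [hμ, div_le_one (by positivity)]
    nlinarith [one_le_mul_of_one_le_of_one_le (one_le_pow₀ (n := 2) hnR) hQR]
  set u : ℝ := h / n ^ 2 with hu
  have hun : n * (u * n) = h := by rw [hu]; field_simp
  have hμQ : μ * Q = u := by rw [hu, hμ]; field_simp
  have hu1 : u ≤ 1 := by
    rw [hu, div_le_one (by positivity)]; nlinarith [one_le_pow₀ (n := 2) hnR]
  set M : (Fin m → Fin n → Fin n → Fin (Q + 1)) → ℕ → Fin n → Fin n → ℝ :=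
    fun θ t j i => if ht : t < m then μ * (θ ⟨t, ht⟩ j i : ℕ) else 0 with hMdef
  have hM0 : ∀ θ t j i, 0 ≤ M θ t j i := by
    intro θ t j i
    simp only [hMdef]
    split_ifs <;> positivity
  have hMu : ∀ θ t j i, M θ t j i ≤ u := by
    intro θ t j i
    simp only [hMdef]
    split_ifs with ht
    · have : ((θ ⟨t, ht⟩ j i : ℕ) : ℝ) ≤ Q := by
        exact_mod_cast Nat.lt_succ_iff.1 (θ ⟨t, ht⟩ j i).2
      rw [← hμQ]; gcongr
    · positivity
  choose f hfmem hf using fun θ => exists_mem_RclassB_eq_cellSum hd hdW hB hW hL hK hh0.le hnh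
    (hM0 θ) fun t j i => (hMu θ t j i).trans hu1
  have hcard := card_le_card_of_separated hp hε f hfmem (fun θ θ' hne => ?_) C hC hcov
  · refine le_trans (le_of_eq ?_) hcard
    simp only [Fintype.card_fun, Fintype.card_fin, ← pow_mul]
    ring_nf
  set A : ℝ := (W * B) ^ (q + 1) with hA
  have hA0 : 0 < A := by
    have : (0 : ℝ) < W := by exact_mod_cast (by omega : 0 < W)
    positivity
  obtain ⟨l, hl, hlmin⟩ := exists_first_ne hne
  obtain ⟨j, hj, hjmin⟩ := exists_first_ne hl
  obtain ⟨i, hi, himin⟩ := exists_first_ne hj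
  obtain ⟨y, hy0, hy1, hy⟩ := exists_cellSum_sub_eq hK hh hun.le (hM0 θ) (hMu θ) (hM0 θ')
    (hMu θ') l.2 (j₀ := j) (i₀ := i)
    (fun t ht => by
      have := hlmin ⟨t, ht.trans l.2⟩ ht
      simp only [hMdef, this])
    (fun t ht => by
      have := hjmin t ht
      simp only [hMdef, Fin.eta, this])
    (fun t ht => by
      have := himin t ht
      simp only [hMdef, Fin.eta, this])
  set η : ℝ := μ * h with hη
  have hη0 : 0 < η := by positivity
  have hηh : η ≤ h := mul_le_of_le_one_left hh0.le hμ1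
  have hpeak : η ≤ |cellSum K h (M θ) m y - cellSum K h (M θ') m y| := by
    rw [hy, abs_mul, abs_of_pos hh0]
    refine mul_le_mul_of_nonneg_right ?_ hh0.le
    simp only [hMdef, l.2, dif_pos, Fin.eta]
    rw [← mul_sub, abs_mul, abs_of_pos hμ0]
    refine le_mul_of_one_le_right hμ0.le ?_
    have hdiff : ((θ l j i : ℕ) : ℤ) - (θ' l j i : ℕ) ≠ 0 := by
      intro h0
      exact hi (Fin.ext (by omega))
    exact_mod_cast Int.one_le_abs hdiff
  obtain ⟨r, hr⟩ : ∃ r : ℝ, r = η / (8 * K) := ⟨_, rfl⟩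
  have hr0 : 0 < r := by rw [hr]; positivity
  have hrK : 8 * K * r = η := by rw [hr]; field_simp
  have hrh : r ≤ h := by nlinarith
  have hlower := ofReal_mul_le_cubeDist hd hp (continuous_of_mem_RclassB (hfmem θ))
    (continuous_of_mem_RclassB (hfmem θ')) (u := y - r) (v := y + r) (c := A * (η / 2))
    (by linarith) (by linarith) (by positivity) (fun x hx hxy => by
      rw [hf θ x hx, hf θ' x hx, ← mul_sub, abs_mul, abs_of_pos hA0]
      gcongr
      have hdist : |y - x ⟨0, hd⟩| ≤ r := by
        rw [abs_le]; constructor <;> linarith [hxy.1, hxy.2]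
      have hun1 : n * (u * n) ≤ 1 := hun.le.trans hh1
      have e1 := abs_cellSum_sub_le K h (hM0 θ) (hMu θ) hun1 m y (x ⟨0, hd⟩)
      have e2 := abs_cellSum_sub_le K h (hM0 θ') (hMu θ') hun1 m y (x ⟨0, hd⟩)
      have e3 : 2 * (n * m) * |y - x ⟨0, hd⟩| ≤ 2 * K * r := by
        rw [← hK]; gcongr
      have e4 := abs_sub_le_iff.1 (e1.trans e3)
      have e5 := abs_sub_le_iff.1 (e2.trans e3)
      rcases le_abs.1 hpeak with h' | h'
      · exact le_abs.2 (Or.inl (by linarith [e4.1, e5.2]))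
      · exact le_abs.2 (Or.inr (by linarith [e4.2, e5.1])))
  refine lt_of_lt_of_le ?_ hlower
  refine (ENNReal.ofReal_lt_ofReal_iff (by nlinarith [mul_pos hA0 hη0])).2 ?_
  have hval : A * (η / 2) * (y + r - (y - r)) =
      A / (128 * K ^ 5 * (n + 1) ^ 4 * n ^ 4 * Q ^ 2) := by
    rw [hr, hη, hμ, hh]
    field_simp
    ring
  rw [hval, lt_div_iff₀ (by positivity)]
  linarith

lemma polynomial_factor_le {W n m : ℕ} (hW : 2 * n + 2 ≤ W) (hW' : 32 ≤ W) (hm : 5 ≤ m) :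
    256 * ((n : ℝ) * m) ^ 5 * (n + 1) ^ 4 * n ^ 4 ≤ (W : ℝ) ^ (4 * m) := by
  have hWR : 2 * (n : ℝ) + 2 ≤ W := by exact_mod_cast hW
  have hW1 : (32 : ℝ) ≤ W := by exact_mod_cast hW'
  have hn1 : (n : ℝ) ≤ W / 2 := by linarith
  have hn2 : (n : ℝ) + 1 ≤ W / 2 := by linarith
  have hm2 : (m : ℝ) ≤ 2 ^ m := by exact_mod_cast Nat.lt_two_pow_self.le
  have h32 : (32 : ℝ) ^ m = (2 ^ m) ^ 5 := by
    rw [show (32 : ℝ) = 2 ^ 5 by norm_num, ← pow_mul, ← pow_mul, mul_comm]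
  calc (256 * ((n : ℝ) * m) ^ 5 * (n + 1) ^ 4 * n ^ 4 : ℝ)
      ≤ 256 * ((W / 2 : ℝ) * 2 ^ m) ^ 5 * (W / 2 : ℝ) ^ 4 * (W / 2 : ℝ) ^ 4 := by gcongr
    _ = (W : ℝ) ^ 13 / 32 * 32 ^ m := by rw [h32]; ring
    _ ≤ (W : ℝ) ^ 13 * (W : ℝ) ^ m := by
        gcongr
        exact div_le_self (by positivity) (by norm_num)
    _ = (W : ℝ) ^ (13 + m) := (pow_add _ _ _).symm
    _ ≤ (W : ℝ) ^ (4 * m) := pow_le_pow_right₀ (by linarith) (by omega)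

end LowerBound

/-- Covering number lower bound for fully-connected ReLU networks with
uniformly bounded weights. -/
theorem covering_lower_bound_fully_connected :
    ∃ c : ℝ, 0 < c ∧
      ∀ (p : ℝ≥0∞) (d W L : ℕ) (B ε : ℝ),
        1 ≤ p → 0 < d → d ≤ W → 60 ≤ W → 60 ≤ L → 1 ≤ B → 0 < ε → ε < 1 / 2 →
        ENNReal.ofReal
            (c * ((W : ℝ) ^ 2 * L) * Real.logb 2 (((W : ℝ) + 1) ^ L * B ^ L / ε))
          ≤ elog2 (coveringNumber (ENNReal.ofReal ε) (RclassB d W L B) (cubeDist d p)) := by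
  refine ⟨1 / 9216, by norm_num, ?_⟩
  intro p d W L B ε hp hd hdW hW hL hB hε hε2
  obtain ⟨m, hm⟩ : ∃ m, m = L / 12 := ⟨_, rfl⟩
  obtain ⟨n, hn⟩ : ∃ n, n = (W - 2) / 2 := ⟨_, rfl⟩
  obtain ⟨q, hq⟩ : ∃ q, q = L - 3 * m - 3 := ⟨_, rfl⟩
  have hm5 : 5 ≤ m := by omega
  have hmR : (5 : ℝ) ≤ m := by exact_mod_cast hm5
  have hWR : (60 : ℝ) ≤ W := by exact_mod_cast hW
  have hWB : (60 : ℝ) ≤ W * B := by nlinarith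
  set X : ℝ := W * B with hX
  set V : ℝ := X ^ (4 * m) / ε with hV
  have hX1 : 1 ≤ X := by linarith
  have hXpow : 1 ≤ X ^ (4 * m) := one_le_pow₀ hX1
  have hV1 : 1 ≤ V := by
    rw [hV, le_div_iff₀ hε]; linarith
  obtain ⟨Q, hQ⟩ : ∃ Q, Q = ⌊√V⌋₊ := ⟨_, rfl⟩
  have hQ0 : 0 < Q := by
    rw [hQ]; exact Nat.floor_pos.2 (Real.one_le_sqrt.2 hV1)
  have hQV : (Q : ℝ) ^ 2 ≤ V := by
    rw [← Real.sq_sqrt (by linarith : 0 ≤ V), hQ]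
    gcongr
    exact Nat.floor_le (Real.sqrt_nonneg V)
  have hVQ : √V ≤ (Q : ℝ) + 1 := by
    rw [hQ]; exact (Nat.lt_floor_add_one _).le
  have hgap : 256 * ((n : ℝ) * m) ^ 5 * (n + 1) ^ 4 * n ^ 4 * Q ^ 2 * ε < X ^ (q + 1) := by
    calc 256 * ((n : ℝ) * m) ^ 5 * (n + 1) ^ 4 * n ^ 4 * Q ^ 2 * ε
        ≤ (W : ℝ) ^ (4 * m) * V * ε := by
          gcongr
          exact polynomial_factor_le (by omega) (by omega) hm5
      _ = (W : ℝ) ^ (4 * m) * X ^ (4 * m) := by rw [hV]; field_simp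
      _ ≤ X ^ (4 * m) * X ^ (4 * m) := by
          gcongr
          exact le_mul_of_one_le_right (by linarith) hB
      _ = X ^ (8 * m) := by rw [← pow_add]; congr 1; ring
      _ < X ^ (q + 1) := pow_lt_pow_right₀ (by linarith) (by omega)
  refine ofReal_le_elog2_coveringNumber (N := (Q + 1) ^ (m * n ^ 2)) (by positivity) ?_
    fun C hC hcov => pow_card_le_card_of_covering hp hd hdW hB hε.le (by omega) (by omega) hQ0
      (by omega) (by omega) hgap C hC hcov
  set lX : ℝ := Real.logb 2 X with hlX
  set lε : ℝ := -Real.logb 2 ε with hlε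
  have hlX0 : 0 ≤ lX := Real.logb_nonneg one_lt_two hX1
  have hlε0 : 0 ≤ lε := by
    have := Real.logb_nonpos one_lt_two hε.le (by linarith : ε ≤ 1)
    linarith
  have hlogQ : 2 * m * lX + lε / 2 ≤ Real.logb 2 ((Q : ℝ) + 1) := by
    refine le_trans (le_of_eq ?_) (Real.logb_le_logb_of_le one_lt_two
      (Real.sqrt_pos.2 (by linarith)) hVQ)
    rw [Real.sqrt_eq_rpow, Real.logb_rpow_eq_mul_logb_of_pos (by linarith), hV,
      Real.logb_div (by positivity) hε.ne', Real.logb_pow]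
    push_cast
    ring
  have hlogT : Real.logb 2 (((W : ℝ) + 1) ^ L * B ^ L / ε) ≤ 24 * (2 * m * lX + lε / 2) := by
    have hLm : (L : ℝ) ≤ 24 * m := by exact_mod_cast (by omega : L ≤ 24 * m)
    have hsq : ((W : ℝ) + 1) * B ≤ X ^ 2 := by
      have h1 : (W : ℝ) + 1 ≤ W ^ 2 := by nlinarith
      have h2 : B ≤ B ^ 2 := by nlinarith
      rw [hX, mul_pow]; gcongr
    have hlog : Real.logb 2 (((W : ℝ) + 1) * B) ≤ 2 * lX := by
      refine (Real.logb_le_logb_of_le one_lt_two (by positivity) hsq).trans (le_of_eq ?_)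
      rw [Real.logb_pow]; push_cast; ring
    rw [← mul_pow, Real.logb_div (by positivity) hε.ne', Real.logb_pow]
    have h3 : (L : ℝ) * Real.logb 2 (((W : ℝ) + 1) * B) ≤ 24 * m * (2 * lX) :=
      (mul_le_mul_of_nonneg_left hlog (by positivity)).trans
        (mul_le_mul_of_nonneg_right hLm (by positivity))
    linarith
  have hsize : (W : ℝ) ^ 2 * L ≤ 384 * (m * n ^ 2) := by
    have h1 : (W : ℝ) ≤ 4 * n := by exact_mod_cast (by omega : W ≤ 4 * n)
    have h2 : (L : ℝ) ≤ 24 * m := by exact_mod_cast (by omega : L ≤ 24 * m)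
    calc (W : ℝ) ^ 2 * L ≤ (4 * n) ^ 2 * (24 * m) := by gcongr
      _ = _ := by ring
  push_cast
  rw [Real.logb_pow]
  push_cast
  set Y : ℝ := 2 * m * lX + lε / 2 with hY
  have hY0 : 0 ≤ Y := by positivity
  calc 1 / 9216 * ((W : ℝ) ^ 2 * L) * Real.logb 2 (((W : ℝ) + 1) ^ L * B ^ L / ε)
      ≤ 1 / 9216 * ((W : ℝ) ^ 2 * L) * (24 * Y) := by gcongr
    _ ≤ 1 / 9216 * (384 * (m * n ^ 2)) * (24 * Y) := by gcongr
    _ = m * n ^ 2 * Y := by ring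
    _ ≤ m * n ^ 2 * Real.logb 2 ((Q : ℝ) + 1) := by gcongr
end
end
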